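/- Let M ∈ C_c^∞(ℝ²) satisfy the flag-F₁ seminorm bounds with constants 𝒞, and let M_η(x) = ∫_ℝ e^{−2πiyη} M(x,y) dy. Then for each α ∈ ℕ the family {η^α ∂_η^α M_η}_{η≠0} is a uniformly bounded family of CZ kernels on ℝ: for all α, β ∈ ℕ there are constants C_{α,β} and C_α, depending only on α, β and 𝒞 (not on η or on the support of M), such that |∂_x^β (η^α ∂_η^α M_η)(x)| ≤ C_{α,β}|x|^{−1−β} for all x ≠ 0 and all η ≠ 0, and |∫_ℝ (η^α ∂_η^α M_η)(x) φ(δx) dx| ≤ C_α for every δ > 0, every η ≠ 0 and every normalized bump function φ. -/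

import Mathlib

open Real Filter Topology MeasureTheory ENNReal NNReal

noncomputable section

/-- `eI r = exp(i r)`. -/
def eI (r : ℝ) : ℂ := Complex.exp (Complex.I * r)

/-- A normalized bump function on `ℝ`: a `C^∞` function supported in `[-1,1]`
with `|φ| ≤ 1` and `|φ'| ≤ 1`. -/
def IsNormalizedBump (φ : ℝ → ℝ) : Prop :=
  ContDiff ℝ (⊤ : ℕ∞) φ ∧ (∀ t : ℝ, 1 < |t| → φ t = 0) ∧
  (∀ t, |φ t| ≤ 1) ∧ (∀ t, |deriv φ t| ≤ 1)

/-- A compactly supported smooth function `M` on `ℝ²` satisfies the flag-`F₁` seminorm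
bounds with constants `𝒞 = (Cab, C1, C2)` if:
(i) `|∂_x^α ∂_y^β M(x,y)| ≤ Cab α β (|x|+|y|^{1/2})^{-1-α} |y|^{-1-β}` for `y ≠ 0`;
(ii) for every normalized bump `φ` and `R > 0`, the functions
`y ↦ ∫ M(x,y) φ(Rx) dx` and `x ↦ ∫ M(x,y) φ(Ry) dy` are CZ kernels on `ℝ`
with constants `(C1, C2)` (decay and cancellation), uniformly in `φ` and `R`. -/
def FlagF1FunBounds (Cab : ℕ → ℕ → ℝ) (C1 : ℕ → ℝ) (C2 : ℝ) (M : ℝ → ℝ → ℂ) : Prop :=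
  ContDiff ℝ (⊤ : ℕ∞) (fun p : ℝ × ℝ => M p.1 p.2) ∧
  HasCompactSupport (fun p : ℝ × ℝ => M p.1 p.2) ∧
  (∀ (α β : ℕ) (x y : ℝ), y ≠ 0 →
    ‖iteratedDeriv α (fun x' : ℝ => iteratedDeriv β (fun y' : ℝ => M x' y') y) x‖
      ≤ Cab α β * (|x| + |y| ^ ((1:ℝ)/2)) ^ (-1 - (α : ℝ)) * |y| ^ (-1 - (β : ℝ))) ∧
  (∀ φ : ℝ → ℝ, IsNormalizedBump φ → ∀ R : ℝ, 0 < R →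
    (∀ (α : ℕ) (y : ℝ), y ≠ 0 →
      ‖iteratedDeriv α (fun y' : ℝ => ∫ x : ℝ, M x y' * (φ (R * x) : ℂ)) y‖
        ≤ C1 α * |y| ^ (-1 - (α : ℝ))) ∧
    (∀ δ : ℝ, 0 < δ → ∀ ψ : ℝ → ℝ, IsNormalizedBump ψ →
      ‖∫ y : ℝ, (∫ x : ℝ, M x y * (φ (R * x) : ℂ)) * (ψ (δ * y) : ℂ)‖ ≤ C2) ∧
    (∀ (α : ℕ) (x : ℝ), x ≠ 0 →
      ‖iteratedDeriv α (fun x' : ℝ => ∫ y : ℝ, M x' y * (φ (R * y) : ℂ)) x‖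
        ≤ C1 α * |x| ^ (-1 - (α : ℝ))) ∧
    (∀ δ : ℝ, 0 < δ → ∀ ψ : ℝ → ℝ, IsNormalizedBump ψ →
      ‖∫ x : ℝ, (∫ y : ℝ, M x y * (φ (R * y) : ℂ)) * (ψ (δ * x) : ℂ)‖ ≤ C2))

/-- A smooth compactly supported function of two real variables, in curried form. -/
def IsTestFunction₂ (F : ℝ → ℝ → ℂ) : Prop :=
  ContDiff ℝ (⊤ : ℕ∞) (fun p : ℝ × ℝ => F p.1 p.2) ∧
    HasCompactSupport (fun p : ℝ × ℝ => F p.1 p.2)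

/-- The partial derivative in the first variable. -/
def partialFst (F : ℝ → ℝ → ℂ) (x y : ℝ) : ℂ := deriv (fun x' => F x' y) x

lemma iterate_partialFst (F : ℝ → ℝ → ℂ) (n : ℕ) (x y : ℝ) :
    partialFst^[n] F x y = iteratedDeriv n (fun x' => F x' y) x := by
  induction n generalizing F with
  | zero => simp
  | succ n ih => rw [Function.iterate_succ_apply, ih, iteratedDeriv_succ']; rfl

namespace IsTestFunction₂

variable {F : ℝ → ℝ → ℂ}

lemma flip (hF : IsTestFunction₂ F) : IsTestFunction₂ (Function.swap F) := by
  refine ⟨hF.1.comp (contDiff_snd.prodMk contDiff_fst), ?_⟩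
  exact hF.2.comp_homeomorph (Homeomorph.prodComm ℝ ℝ)

lemma hasDerivAt_fst (hF : IsTestFunction₂ F) (x y : ℝ) :
    HasDerivAt (fun x' => F x' y) (fderiv ℝ (fun p : ℝ × ℝ => F p.1 p.2) (x, y) (1, 0)) x := by
  have h := (hF.1.differentiable (by simp) (x, y)).hasFDerivAt
  exact h.comp_hasDerivAt x ((hasDerivAt_id x).prodMk (hasDerivAt_const x y))

lemma deriv_fst (hF : IsTestFunction₂ F) : IsTestFunction₂ (partialFst F) := by
  have h : (fun p : ℝ × ℝ => partialFst F p.1 p.2) =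
      fun p => fderiv ℝ (fun p : ℝ × ℝ => F p.1 p.2) p (1, 0) := by
    funext p
    exact (hF.hasDerivAt_fst p.1 p.2).deriv
  refine ⟨?_, ?_⟩
  · rw [h]
    exact (hF.1.fderiv_right (m := ((⊤ : ℕ∞) : WithTop ℕ∞)) (by simp)).clm_apply contDiff_const
  · rw [h]
    exact hF.2.fderiv_apply ℝ _

lemma iterate_deriv_fst (hF : IsTestFunction₂ F) (n : ℕ) :
    IsTestFunction₂ (partialFst^[n] F) := by
  induction n generalizing F with
  | zero => exact hF
  | succ n ih => exact ih hF.deriv_fst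

lemma iteratedDeriv_snd (hF : IsTestFunction₂ F) (n : ℕ) :
    IsTestFunction₂ (fun x y => iteratedDeriv n (F x) y) := by
  convert (hF.flip.iterate_deriv_fst n).flip using 1
  funext x y
  exact (iterate_partialFst (Function.swap F) n y x).symm

lemma contDiff_right (hF : IsTestFunction₂ F) (x : ℝ) : ContDiff ℝ (⊤ : ℕ∞) (F x) :=
  hF.1.comp (contDiff_const.prodMk contDiff_id)

lemma hasCompactSupport_right (hF : IsTestFunction₂ F) (x : ℝ) : HasCompactSupport (F x) :=
  by
  have h : IsClosedEmbedding (fun y : ℝ => (x, y)) :=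
    (Isometry.of_dist_eq fun a b => by simp [Prod.dist_eq]).isClosedEmbedding
  exact hF.2.comp_isClosedEmbedding h

lemma exists_bound (hF : IsTestFunction₂ F) :
    ∃ C r : ℝ, ∀ x y, ‖F x y‖ ≤ C ∧ (r < |y| → F x y = 0) := by
  obtain ⟨C, hC⟩ := hF.2.exists_bound_of_continuous hF.1.continuous
  obtain ⟨r, hr⟩ := hF.2.isCompact.isBounded.subset_closedBall 0
  refine ⟨C, r, fun x y => ⟨hC (x, y), fun hy => ?_⟩⟩
  by_contra h
  have := hr (subset_tsupport _ (show (x, y) ∈ Function.support _ from h))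
  rw [mem_closedBall_zero_iff, Prod.norm_def] at this
  exact absurd ((le_max_right _ _).trans this) (by simpa using hy)

/-- Differentiation under the integral sign against a continuous weight. -/
lemma hasDerivAt_integral (hF : IsTestFunction₂ F) {w : ℝ → ℂ} (hw : Continuous w) (x : ℝ) :
    HasDerivAt (fun x' => ∫ y, F x' y * w y) (∫ y, partialFst F x y * w y) x := by
  obtain ⟨C, r, hC⟩ := hF.deriv_fst.exists_bound
  have cont (G : ℝ → ℝ → ℂ) (hG : IsTestFunction₂ G) (x : ℝ) :
      Continuous (fun y => G x y * w y) := (hG.contDiff_right x).continuous.mul hw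
  refine (hasDerivAt_integral_of_dominated_loc_of_deriv_le
    (F' := fun x' y => partialFst F x' y * w y)
    (bound := (Set.Icc (-r) r).indicator fun y => C * ‖w y‖) (s := Set.univ) Filter.univ_mem
    (Eventually.of_forall fun x' => (cont F hF x').aestronglyMeasurable)
    ((cont F hF x).integrable_of_hasCompactSupport ((hF.hasCompactSupport_right x).mul_right))
    (cont _ hF.deriv_fst x).aestronglyMeasurable ?_ ?_ ?_).2
  · refine Eventually.of_forall fun y x' _ => ?_
    by_cases hy : y ∈ Set.Icc (-r) r
    · rw [Set.indicator_of_mem hy, norm_mul]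
      gcongr
      exact (hC x' y).1
    · rw [Set.indicator_of_notMem hy, (hC x' y).2, zero_mul, norm_zero]
      rw [Set.mem_Icc, ← abs_le] at hy
      exact not_le.mp hy
  · exact (ContinuousOn.integrableOn_compact isCompact_Icc (by fun_prop)).integrable_indicator
      measurableSet_Icc
  · refine Eventually.of_forall fun y x' _ => ?_
    have h := hF.hasDerivAt_fst x' y
    exact (h.differentiableAt.hasDerivAt).mul_const (w y)

lemma iteratedDeriv_integral (hF : IsTestFunction₂ F) {w : ℝ → ℂ} (hw : Continuous w) (n : ℕ)
    (x : ℝ) :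
    iteratedDeriv n (fun x' => ∫ y, F x' y * w y) x =
      ∫ y, iteratedDeriv n (fun x' => F x' y) x * w y := by
  simp_rw [← iterate_partialFst]
  induction n generalizing F with
  | zero => simp
  | succ n ih =>
    rw [iteratedDeriv_succ', funext fun x => (hF.hasDerivAt_integral hw x).deriv,
      ih hF.deriv_fst]
    rfl

lemma contDiff_integral (hF : IsTestFunction₂ F) {w : ℝ → ℂ} (hw : Continuous w) :
    ContDiff ℝ (⊤ : ℕ∞) (fun x => ∫ y, F x y * w y) := by
  refine contDiff_of_differentiable_iteratedDeriv fun n _ x => ?_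
  have h := (hF.iterate_deriv_fst n).hasDerivAt_integral hw x
  simp_rw [iterate_partialFst F n, ← hF.iteratedDeriv_integral hw n] at h
  exact h.differentiableAt

lemma integral_integral_swap_mul (hF : IsTestFunction₂ F) {v w : ℝ → ℂ} (hv : Continuous v)
    (hw : Continuous w) :
    ∫ x, (∫ y, F x y * w y) * v x = ∫ y, (∫ x, F x y * v x) * w y := by
  simp_rw [← integral_mul_const]
  rw [integral_integral_swap_of_hasCompactSupport]
  · simp_rw [mul_right_comm]
  · have := hF.1.continuous
    exact (this.mul (hw.comp continuous_snd)).mul (hv.comp continuous_fst)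
  · exact (HasCompactSupport.mul_right (f' := fun p : ℝ × ℝ => w p.2) hF.2).mul_right
      (f' := fun p : ℝ × ℝ => v p.1)

end IsTestFunction₂

open Polynomial in
lemma exists_derivative_add_C_mul_eq {c : ℂ} (hc : c ≠ 0) (n : ℕ) (P : ℂ[X])
    (hP : P.natDegree ≤ n) : ∃ Q : ℂ[X], Q.natDegree ≤ n ∧ derivative Q + C c * Q = P := by
  induction n generalizing P with
  | zero =>
    refine ⟨C (c⁻¹ * P.coeff 0), (natDegree_C _).le, ?_⟩
    rw [derivative_C, zero_add, ← C_mul, mul_inv_cancel_left₀ hc,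
      ← eq_C_of_natDegree_le_zero hP]
  | succ n ih =>
    obtain ⟨Q, hQ, h⟩ := ih (C c⁻¹ * derivative P)
      ((natDegree_C_mul_le _ _).trans ((natDegree_derivative_le P).trans (by omega)))
    refine ⟨C c⁻¹ * P - Q, ?_, ?_⟩
    · exact (natDegree_sub_le _ _).trans
        (max_le ((natDegree_C_mul_le _ _).trans hP) (hQ.trans n.le_succ))
    · have hcc : C c * C c⁻¹ = (1 : ℂ[X]) := by rw [← C_mul, mul_inv_cancel₀ hc, C_1]
      rw [derivative_sub, derivative_C_mul]
      linear_combination P * hcc - h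

open Polynomial in
/-- A polynomial times an exponential has iterated antiderivatives of the same form. -/
lemma exists_iteratedDeriv_eval_mul_exp {c : ℂ} (hc : c ≠ 0) (n N : ℕ) (P : ℂ[X])
    (hP : P.natDegree ≤ n) : ∃ Q : ℂ[X], Q.natDegree ≤ n ∧
      iteratedDeriv N (fun t : ℝ => Q.eval (t : ℂ) * Complex.exp (c * t)) =
        fun t : ℝ => P.eval (t : ℂ) * Complex.exp (c * t) := by
  induction N generalizing P with
  | zero => exact ⟨P, hP, by simp⟩
  | succ N ih =>
    obtain ⟨Q₁, hQ₁, h₁⟩ := ih P hP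
    obtain ⟨Q, hQ, h⟩ := exists_derivative_add_C_mul_eq hc n Q₁ hQ₁
    refine ⟨Q, hQ, ?_⟩
    rw [iteratedDeriv_succ', ← h₁]
    congr 1
    funext t
    have hE : HasDerivAt (fun z : ℂ => Complex.exp (c * z)) (Complex.exp (c * t) * (c * 1)) t :=
      ((hasDerivAt_id (t : ℂ)).const_mul c).cexp
    have := ((Q.hasDerivAt (t : ℂ)).mul hE).comp_ofReal
    refine this.deriv.trans ?_
    rw [← h]
    simp only [eval_add, eval_mul, eval_C]
    ring

open Polynomial in
lemma exists_norm_eval_le_mul_abs_pow (n : ℕ) (Q : ℂ[X]) (hQ : Q.natDegree ≤ n) :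
    ∃ C : ℝ, 0 ≤ C ∧ ∀ t : ℝ, 1 / 2 ≤ |t| → ‖Q.eval (t : ℂ)‖ ≤ C * |t| ^ n := by
  refine ⟨∑ i ∈ Finset.range (n + 1), ‖Q.coeff i‖ * 2 ^ (n - i), by positivity, fun t ht => ?_⟩
  rw [eval_eq_sum_range' (Nat.lt_succ_of_le hQ), Finset.sum_mul]
  refine (norm_sum_le _ _).trans (Finset.sum_le_sum fun i hi => ?_)
  rw [norm_mul, norm_pow, Complex.norm_real, Real.norm_eq_abs, mul_assoc]
  gcongr
  have hi : i ≤ n := Nat.lt_succ_iff.mp (Finset.mem_range.mp hi)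
  calc |t| ^ i ≤ (2 * |t|) ^ (n - i) * |t| ^ i :=
        le_mul_of_one_le_left (by positivity) (one_le_pow₀ (by linarith))
    _ = 2 ^ (n - i) * |t| ^ n := by
        rw [mul_pow, mul_assoc, ← pow_add, Nat.sub_add_cancel hi]

/-- A smooth complex function supported in `[-1, 1]` is a combination of normalized bumps. -/
lemma exists_isNormalizedBump_decomposition {B : ℝ → ℂ} (hB : ContDiff ℝ (⊤ : ℕ∞) B)
    (hsupp : ∀ t, 1 < |t| → B t = 0) :
    ∃ (C : ℝ) (b₁ b₂ : ℝ → ℝ), 0 ≤ C ∧ IsNormalizedBump b₁ ∧ IsNormalizedBump b₂ ∧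
      ∀ t, B t = C * (b₁ t + Complex.I * b₂ t) := by
  have hcs : HasCompactSupport B := by
    refine HasCompactSupport.of_support_subset_isCompact (isCompact_Icc (a := -1) (b := 1)) ?_
    intro t ht
    rw [Set.mem_Icc, ← abs_le]
    exact not_lt.mp fun h => ht (hsupp t h)
  obtain ⟨C₀, h₀⟩ := hcs.exists_bound_of_continuous hB.continuous
  obtain ⟨C₁, h₁⟩ := hcs.deriv.exists_bound_of_continuous (hB.continuous_deriv (by simp))
  set C : ℝ := max 1 (max C₀ C₁) with hC
  have hCpos : 0 < C := zero_lt_one.trans_le (le_max_left _ _)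
  have key (L : ℂ →L[ℝ] ℝ) (hL : ∀ z, |L z| ≤ ‖z‖) : IsNormalizedBump (fun t => L (B t) / C) := by
    refine ⟨(L.contDiff.comp hB).div_const C, fun t ht => by simp [hsupp t ht], fun t => ?_,
      fun t => ?_⟩
    · rw [abs_div, abs_of_pos hCpos, div_le_one hCpos]
      exact (hL _).trans ((h₀ t).trans ((le_max_left _ _).trans (le_max_right _ _)))
    · have hd : HasDerivAt (fun t => L (B t)) (L (deriv B t)) t :=
        L.hasFDerivAt.comp_hasDerivAt t (hB.differentiable (by simp) t).hasDerivAt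
      rw [(hd.div_const C).deriv, abs_div, abs_of_pos hCpos, div_le_one hCpos]
      exact (hL _).trans ((h₁ t).trans ((le_max_right _ _).trans (le_max_right _ _)))
  refine ⟨C, _, _, hCpos.le, key Complex.reCLM Complex.abs_re_le_norm,
    key Complex.imCLM Complex.abs_im_le_norm, fun t => ?_⟩
  have hC' : (C : ℂ) ≠ 0 := by exact_mod_cast hCpos.ne'
  simp only [Complex.reCLM_apply, Complex.imCLM_apply, Complex.ofReal_div]
  field_simp
  rw [mul_comm Complex.I, Complex.re_add_im]

/-- The oscillatory kernel `(c t) ^ α * exp (c t)` is the sum of a multiple of a complex bump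
and the `(α + 1)`-st derivative of a function of growth `|t| ^ α` vanishing near the origin. -/
lemma exists_oscillatory_kernel_decomposition {c : ℂ} (hc : c ≠ 0) (hre : c.re = 0) (α : ℕ) :
    ∃ (C C' : ℝ) (b₁ b₂ : ℝ → ℝ) (V : ℝ → ℂ), 0 ≤ C ∧ 0 ≤ C' ∧
      IsNormalizedBump b₁ ∧ IsNormalizedBump b₂ ∧
      ContDiff ℝ (⊤ : ℕ∞) V ∧ (∀ t, |t| ≤ 1 / 2 → V t = 0) ∧ (∀ t, ‖V t‖ ≤ C' * |t| ^ α) ∧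
      ∀ t : ℝ, (c * t) ^ α * Complex.exp (c * t) =
        C * (b₁ t + Complex.I * b₂ t) + iteratedDeriv (α + 1) V t := by
  obtain ⟨Q, hQ, h⟩ := exists_iteratedDeriv_eval_mul_exp hc α (α + 1)
    ((Polynomial.C c * Polynomial.X) ^ α)
    (Polynomial.natDegree_pow_le.trans (by
      rw [Polynomial.natDegree_C_mul_X c hc, mul_one]))
  set K : ℝ → ℂ := fun t => Q.eval (t : ℂ) * Complex.exp (c * t) with hKdef
  have hK : ContDiff ℝ (⊤ : ℕ∞) K := by
    have h1 : ContDiff ℝ (⊤ : ℕ∞) (fun t : ℝ => (t : ℂ)) := Complex.ofRealCLM.contDiff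
    have h2 : ContDiff ℝ (⊤ : ℕ∞) (fun z : ℂ => Q.eval z) :=
      (Q.contDiff_aeval (𝕜 := ℂ) _).restrict_scalars ℝ
    exact (h2.comp h1).mul (contDiff_const.mul h1).cexp
  obtain ⟨C₁, hC₁, hbound⟩ := exists_norm_eval_le_mul_abs_pow α Q hQ
  let φ : ContDiffBump (0 : ℝ) := ⟨1 / 2, 1, by norm_num, by norm_num⟩
  have hφ : ContDiff ℝ (⊤ : ℕ∞) (fun t => (φ t : ℂ)) := Complex.ofRealCLM.contDiff.comp φ.contDiff
  set V : ℝ → ℂ := fun t => (1 - φ t) * K t with hVdef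
  have hV : ContDiff ℝ (⊤ : ℕ∞) V := (contDiff_const.sub hφ).mul hK
  set U : ℝ → ℂ := fun t => φ t * K t with hUdef
  have hU : ContDiff ℝ (⊤ : ℕ∞) U := hφ.mul hK
  obtain ⟨C₀, b₁, b₂, hC₀, hb₁, hb₂, hb⟩ :=
    exists_isNormalizedBump_decomposition (B := iteratedDeriv (α + 1) U)
      (by rw [iteratedDeriv_eq_iterate]; exact hU.iterate_deriv (α + 1)) (by
      intro t ht
      have : U =ᶠ[𝓝 t] fun _ => 0 := by
        filter_upwards [(isOpen_lt continuous_const continuous_abs).mem_nhds ht] with s hs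
        have : φ s = 0 := φ.zero_of_le_dist (by simpa using hs.le)
        simp [hUdef, this]
      rw [this.iteratedDeriv_eq]
      simp)
  have hV0 (t : ℝ) (ht : |t| ≤ 1 / 2) : V t = 0 := by
    have : φ t = 1 := φ.one_of_mem_closedBall (by
      rw [Metric.mem_closedBall, dist_zero_right]
      exact ht)
    simp [hVdef, this]
  refine ⟨C₀, C₁, b₁, b₂, V, hC₀, hC₁, hb₁, hb₂, hV, hV0, fun t => ?_, fun t => ?_⟩
  · rcases le_or_gt |t| (1 / 2) with ht | ht
    · rw [hV0 t ht, norm_zero]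
      positivity
    · have hexp : ‖Complex.exp (c * t)‖ = 1 := by
        rw [Complex.norm_exp]
        simp [hre]
      have hφ1 : ‖(1 - φ t : ℂ)‖ ≤ 1 := by
        rw [← Complex.ofReal_one, ← Complex.ofReal_sub, Complex.norm_real, Real.norm_eq_abs,
          abs_of_nonneg (sub_nonneg.mpr φ.le_one)]
        linarith [φ.nonneg' t]
      calc ‖V t‖ = ‖(1 - φ t : ℂ)‖ * ‖Q.eval (t : ℂ)‖ := by
            rw [hVdef, norm_mul, hKdef, norm_mul, hexp, mul_one]
        _ ≤ 1 * (C₁ * |t| ^ α) := by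
            gcongr
            exact hbound t ht.le
        _ = C₁ * |t| ^ α := one_mul _
  · have hsum : K = U + V := by
      funext t
      simp only [hUdef, hVdef, Pi.add_apply]
      ring
    have hle : ((α + 1 : ℕ) : WithTop ℕ∞) ≤ ((⊤ : ℕ∞) : WithTop ℕ∞) := by
      exact_mod_cast le_top
    rw [← hb, ← iteratedDeriv_add (hU.of_le hle).contDiffAt (hV.of_le hle).contDiffAt, ← hsum, h]
    simp

/-- Repeated integration by parts against a dilated function. -/
lemma integral_mul_iteratedDeriv_comp_mul {V : ℝ → ℂ} (hV : ContDiff ℝ (⊤ : ℕ∞) V) {R : ℝ}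
    (hR : R ≠ 0) (N : ℕ) {g : ℝ → ℂ} (hg : ContDiff ℝ (⊤ : ℕ∞) g) (hgs : HasCompactSupport g) :
    ∫ y, g y * iteratedDeriv N V (R * y) =
      (-1 / (R : ℂ)) ^ N * ∫ y, iteratedDeriv N g y * V (R * y) := by
  induction N generalizing V with
  | zero => simp
  | succ N ih =>
    have hV' : ContDiff ℝ (⊤ : ℕ∞) (deriv V) := (contDiff_infty_iff_deriv.mp hV).2
    rw [iteratedDeriv_succ', ih hV', pow_succ, mul_assoc]
    congr 1
    have hu : ContDiff ℝ (⊤ : ℕ∞) (iteratedDeriv N g) := by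
      rw [iteratedDeriv_eq_iterate]
      exact hg.iterate_deriv N
    have hus : HasCompactSupport (iteratedDeriv N g) := by
      rw [iteratedDeriv_eq_iterate]
      clear * - hgs
      induction N with
      | zero => exact hgs
      | succ N ih =>
        rw [Function.iterate_succ_apply']
        exact ih.deriv
    have hRy : Continuous fun y : ℝ => R * y := by fun_prop
    have hv (y : ℝ) : HasDerivAt (fun y => V (R * y)) ((R : ℂ) * deriv V (R * y)) y := by
      have h1 : HasDerivAt (fun y : ℝ => R * y) R y := by simpa using (hasDerivAt_id y).const_mul R
      have := (hV.differentiable (by simp) (R * y)).hasDerivAt.scomp y h1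
      simpa [Function.comp_def] using this
    have hud : Continuous (deriv (iteratedDeriv N g)) := hu.continuous_deriv (by simp)
    have parts := integral_mul_deriv_eq_deriv_mul_of_integrable
      (u := iteratedDeriv N g) (u' := deriv (iteratedDeriv N g))
      (v := fun y => V (R * y)) (v' := fun y => (R : ℂ) * deriv V (R * y))
      (fun y _ => (hu.differentiable (by simp) y).hasDerivAt) (fun y _ => hv y)
      ((hu.continuous.mul (continuous_const.mul (hV'.continuous.comp
        hRy))).integrable_of_hasCompactSupport hus.mul_right)
      ((hud.mul (hV.continuous.comp hRy)).integrable_of_hasCompactSupport hus.deriv.mul_right)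
      ((hu.continuous.mul (hV.continuous.comp hRy)).integrable_of_hasCompactSupport
        hus.mul_right)
    rw [iteratedDeriv_succ, ← neg_eq_iff_eq_neg.mpr parts]
    simp_rw [mul_left_comm _ (R : ℂ)]
    rw [integral_const_mul]
    have hR' : (R : ℂ) ≠ 0 := by exact_mod_cast hR
    field_simp

/-- Integrating a function with decay `|y| ^ (-2 - α)` against a dilated function of growth
`|t| ^ α` that vanishes near the origin. -/
lemma norm_integral_mul_comp_mul_le {V h : ℝ → ℂ} {C s R : ℝ} (α : ℕ) (hC : 0 ≤ C) (hs : 0 ≤ s)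
    (hR : 0 < R) (hV0 : ∀ t, |t| ≤ 1 / 2 → V t = 0) (hV : ∀ t, ‖V t‖ ≤ C * |t| ^ α)
    (hh : ∀ y, y ≠ 0 → ‖h y‖ ≤ s * |y| ^ (-1 - ((α + 1 : ℕ) : ℝ))) :
    ‖(-1 / (R : ℂ)) ^ (α + 1) * ∫ y, h y * V (R * y)‖ ≤ 5 * π * C * s := by
  have hint : Integrable fun y : ℝ => 5 * s * C * R ^ (α + 2) * (1 + (R * y) ^ 2)⁻¹ :=
    (integrable_inv_one_add_sq.comp_mul_left' hR.ne').const_mul _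
  have key : ‖∫ y, h y * V (R * y)‖ ≤ 5 * s * C * R ^ (α + 2) * (R⁻¹ * π) := by
    refine (norm_integral_le_of_norm_le hint (Eventually.of_forall fun y => ?_)).trans_eq ?_
    · rcases le_or_gt |R * y| (1 / 2) with hy | hy
      · rw [hV0 _ hy, mul_zero, norm_zero]
        positivity
      · have hy0 : y ≠ 0 := by
          rintro rfl
          norm_num at hy
        have hya : 0 < |y| := abs_pos.mpr hy0
        have hpow : |y| ^ (-1 - ((α + 1 : ℕ) : ℝ)) = (|y| ^ (α + 2))⁻¹ := by
          rw [← Real.rpow_natCast, ← Real.rpow_neg hya.le]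
          congr 1
          push_cast
          ring
        have hsq : 1 / 4 < (R * y) ^ 2 := by
          rw [← sq_abs]
          nlinarith
        have hsq' : ((R * y) ^ 2)⁻¹ ≤ 5 * (1 + (R * y) ^ 2)⁻¹ := by
          rw [← div_eq_mul_inv, le_div_iff₀ (by positivity), inv_mul_le_iff₀ (by positivity)]
          linarith
        calc ‖h y * V (R * y)‖ ≤ (s * (|y| ^ (α + 2))⁻¹) * (C * |R * y| ^ α) := by
              rw [norm_mul, ← hpow]
              gcongr
              · exact hh y hy0
              · exact hV _
          _ = s * C * R ^ (α + 2) * ((R * y) ^ 2)⁻¹ := by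
              rw [abs_mul, abs_of_pos hR, mul_pow R y, ← sq_abs y]
              field_simp
              ring
          _ ≤ s * C * R ^ (α + 2) * (5 * (1 + (R * y) ^ 2)⁻¹) := by gcongr
          _ = _ := by ring
    · rw [integral_const_mul, Measure.integral_comp_mul_left (fun t : ℝ => (1 + t ^ 2)⁻¹),
        integral_univ_inv_one_add_sq, abs_of_pos (inv_pos.mpr hR), smul_eq_mul]
  rw [norm_mul, norm_pow, norm_div, norm_neg, norm_one, Complex.norm_real, Real.norm_eq_abs,
    abs_of_pos hR]
  calc (1 / R) ^ (α + 1) * ‖∫ y, h y * V (R * y)‖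
      ≤ (1 / R) ^ (α + 1) * (5 * s * C * R ^ (α + 2) * (R⁻¹ * π)) := by gcongr
    _ = 5 * π * C * s := by
      rw [one_div, inv_pow]
      field_simp
      ring

lemma integral_const_mul_add_I_mul_add {u v w : ℝ → ℂ} (hu : Integrable u) (hv : Integrable v)
    (hw : Integrable w) (a b : ℂ) :
    ∫ t, (a * (u t + Complex.I * v t) + b * w t) =
      a * ((∫ t, u t) + Complex.I * ∫ t, v t) + b * ∫ t, w t := by
  have huv : Integrable fun t => u t + Complex.I * v t := hu.add (hv.const_mul _)
  rw [integral_add (huv.const_mul a) (hw.const_mul b), integral_const_mul, integral_const_mul,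
    integral_add hu (hv.const_mul _), integral_const_mul]

/-- The Calderón-Zygmund bounds for the integrals of a flag kernel against the dilates of
`(c t) ^ α * exp (c t)`, with `c` purely imaginary. -/
lemma FlagF1FunBounds.exists_oscillatory_bounds (Cab : ℕ → ℕ → ℝ) (C1 : ℕ → ℝ) (C2 : ℝ) {c : ℂ}
    (hc : c ≠ 0) (hre : c.re = 0) (α : ℕ) :
    ∃ (D : ℕ → ℝ) (E : ℝ), ∀ M : ℝ → ℝ → ℂ, FlagF1FunBounds Cab C1 C2 M → ∀ R : ℝ, 0 < R →
      (∀ (β : ℕ) (x : ℝ), x ≠ 0 →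
        ‖iteratedDeriv β (fun x' : ℝ => ∫ y : ℝ, M x' y *
          ((c * (R * y : ℝ)) ^ α * Complex.exp (c * (R * y : ℝ)))) x‖
            ≤ D β * |x| ^ (-1 - (β : ℝ))) ∧
      (∀ δ : ℝ, 0 < δ → ∀ φ : ℝ → ℝ, IsNormalizedBump φ →
        ‖∫ x : ℝ, (∫ y : ℝ, M x y *
          ((c * (R * y : ℝ)) ^ α * Complex.exp (c * (R * y : ℝ)))) * (φ (δ * x) : ℂ)‖ ≤ E) := by
  obtain ⟨C, C', b₁, b₂, V, hC, hC', hb₁, hb₂, hV, hV0, hVb, hdecomp⟩ :=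
    exists_oscillatory_kernel_decomposition hc hre α
  refine ⟨fun β => C * (C1 β + C1 β) + 5 * π * C' * |Cab β (α + 1)|,
    C * (C2 + C2) + 5 * π * C' * |C1 (α + 1)|, ?_⟩
  rintro M ⟨hM₁, hM₂, hdecay, hcancel⟩ R hR
  have hM : IsTestFunction₂ M := ⟨hM₁, hM₂⟩
  have hMN := hM.iteratedDeriv_snd (α + 1)
  have hofReal {b : ℝ → ℝ} (hb : IsNormalizedBump b) (r : ℝ) :
      Continuous fun y : ℝ => (b (r * y) : ℂ) :=
    Complex.continuous_ofReal.comp (hb.1.continuous.comp (by fun_prop))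
  have hVR : Continuous fun y : ℝ => V (R * y) := hV.continuous.comp (by fun_prop)
  have hDV : Continuous fun y : ℝ => iteratedDeriv (α + 1) V (R * y) := by
    rw [iteratedDeriv_eq_iterate]
    exact (hV.iterate_deriv (α + 1)).continuous.comp (continuous_const_mul R)
  set I₁ : ℝ → ℂ := fun x => ∫ y, M x y * (b₁ (R * y) : ℂ) with hI₁
  set I₂ : ℝ → ℂ := fun x => ∫ y, M x y * (b₂ (R * y) : ℂ) with hI₂
  set J : ℝ → ℂ := fun x => ∫ y, iteratedDeriv (α + 1) (M x) y * V (R * y) with hJ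
  have hI₁s : ContDiff ℝ (⊤ : ℕ∞) I₁ := hM.contDiff_integral (hofReal hb₁ R)
  have hI₂s : ContDiff ℝ (⊤ : ℕ∞) I₂ := hM.contDiff_integral (hofReal hb₂ R)
  have hJs : ContDiff ℝ (⊤ : ℕ∞) J := hMN.contDiff_integral hVR
  have hsplit : (fun x' : ℝ => ∫ y : ℝ, M x' y *
      ((c * (R * y : ℝ)) ^ α * Complex.exp (c * (R * y : ℝ)))) =
      fun x => (C : ℂ) * (I₁ x + Complex.I * I₂ x) + (-1 / (R : ℂ)) ^ (α + 1) * J x := by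
    funext x
    have hint {w : ℝ → ℂ} (hw : Continuous w) : Integrable fun y => M x y * w y :=
      ((hM.contDiff_right x).continuous.mul hw).integrable_of_hasCompactSupport
        (hM.hasCompactSupport_right x).mul_right
    rw [hJ, ← integral_mul_iteratedDeriv_comp_mul hV hR.ne' (α + 1) (hM.contDiff_right x)
      (hM.hasCompactSupport_right x), hI₁, hI₂,
      ← one_mul (∫ y, M x y * iteratedDeriv (α + 1) V (R * y)),
      ← integral_const_mul_add_I_mul_add (hint (hofReal hb₁ R)) (hint (hofReal hb₂ R))
        (hint hDV)]
    refine integral_congr_ae (Eventually.of_forall fun y => ?_)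
    simp only [hdecomp]
    ring
  have hle (n : ℕ) : (n : WithTop ℕ∞) ≤ ((⊤ : ℕ∞) : WithTop ℕ∞) := by exact_mod_cast le_top
  have hcomb {z₁ z₂ : ℂ} {B : ℝ} (h₁ : ‖z₁‖ ≤ B) (h₂ : ‖z₂‖ ≤ B) :
      ‖(C : ℂ) * (z₁ + Complex.I * z₂)‖ ≤ C * (B + B) := by
    rw [norm_mul, Complex.norm_real, Real.norm_eq_abs, abs_of_nonneg hC]
    gcongr
    refine (norm_add_le _ _).trans (add_le_add h₁ ?_)
    rwa [norm_mul, Complex.norm_I, one_mul]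
  refine ⟨fun β x hx => ?_, fun δ hδ φ hφ => ?_⟩
  · have hx' : 0 < |x| := abs_pos.mpr hx
    have hsum : iteratedDeriv β (fun x => (C : ℂ) * (I₁ x + Complex.I * I₂ x) +
        (-1 / (R : ℂ)) ^ (α + 1) * J x) x =
        (C : ℂ) * (iteratedDeriv β I₁ x + Complex.I * iteratedDeriv β I₂ x) +
          (-1 / (R : ℂ)) ^ (α + 1) * iteratedDeriv β J x := by
      have h₁ := (hI₁s.of_le (hle β)).contDiffAt (x := x)
      have h₂ := (hI₂s.of_le (hle β)).contDiffAt (x := x)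
      have h₃ := (hJs.of_le (hle β)).contDiffAt (x := x)
      rw [iteratedDeriv_fun_add (contDiffAt_const.mul (h₁.add (contDiffAt_const.mul h₂)))
        (contDiffAt_const.mul h₃), iteratedDeriv_const_mul_field, iteratedDeriv_const_mul_field,
        iteratedDeriv_fun_add h₁ (contDiffAt_const.mul h₂), iteratedDeriv_const_mul_field]
    rw [hsplit, hsum, hJ, hMN.iteratedDeriv_integral hVR]
    refine (norm_add_le _ _).trans ?_
    have near := hcomb ((hcancel b₁ hb₁ R hR).2.2.1 β x hx) ((hcancel b₂ hb₂ R hR).2.2.1 β x hx)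
    have far := norm_integral_mul_comp_mul_le (V := V)
      (h := fun y => iteratedDeriv β (fun x' => iteratedDeriv (α + 1) (M x') y) x)
      (s := |Cab β (α + 1)| * |x| ^ (-1 - (β : ℝ))) α hC' (by positivity) hR hV0 hVb
      (fun y hy => (hdecay β (α + 1) x y hy).trans
        (mul_le_mul_of_nonneg_right (mul_le_mul (le_abs_self _)
          (Real.rpow_le_rpow_of_nonpos hx' (le_add_of_nonneg_right (by positivity))
            (by linarith [Nat.cast_nonneg (α := ℝ) β])) (by positivity) (abs_nonneg _))
          (by positivity)))
    calc _ ≤ _ := add_le_add near far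
      _ = _ := by ring
  · have hJφ : ∫ x, J x * (φ (δ * x) : ℂ) = ∫ y, iteratedDeriv (α + 1)
        (fun y' => ∫ x, M x y' * (φ (δ * x) : ℂ)) y * V (R * y) := by
      rw [hJ, hMN.integral_integral_swap_mul (hofReal hφ δ) hVR]
      refine integral_congr_ae (Eventually.of_forall fun y => ?_)
      simp only
      rw [hM.flip.iteratedDeriv_integral (hofReal hφ δ)]
    have hφs : HasCompactSupport fun x : ℝ => (φ (δ * x) : ℂ) := by
      refine HasCompactSupport.of_support_subset_isCompact
        (isCompact_Icc (a := -δ⁻¹) (b := δ⁻¹)) fun x hx => ?_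
      rw [Set.mem_Icc, ← abs_le]
      by_contra! h
      refine hx ?_
      simp only
      rw [hφ.2.1, Complex.ofReal_zero]
      rw [abs_mul, abs_of_pos hδ]
      exact (inv_lt_iff_one_lt_mul₀' hδ).mp h
    have hint {f : ℝ → ℂ} (hf : ContDiff ℝ (⊤ : ℕ∞) f) :
        Integrable fun x => f x * (φ (δ * x) : ℂ) :=
      (hf.continuous.mul (hofReal hφ δ)).integrable_of_hasCompactSupport hφs.mul_left
    have hsum : ∫ x, ((C : ℂ) * (I₁ x + Complex.I * I₂ x) +
        (-1 / (R : ℂ)) ^ (α + 1) * J x) * (φ (δ * x) : ℂ) =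
        (C : ℂ) * ((∫ x, I₁ x * (φ (δ * x) : ℂ)) + Complex.I * ∫ x, I₂ x * (φ (δ * x) : ℂ)) +
          (-1 / (R : ℂ)) ^ (α + 1) * ∫ x, J x * (φ (δ * x) : ℂ) := by
      rw [← integral_const_mul_add_I_mul_add (hint hI₁s) (hint hI₂s) (hint hJs)]
      refine integral_congr_ae (Eventually.of_forall fun x => ?_)
      simp only
      ring
    simp_rw [congrFun hsplit]
    rw [hsum, hJφ]
    refine (norm_add_le _ _).trans (add_le_add ?_ ?_)
    · exact hcomb ((hcancel b₁ hb₁ R hR).2.2.2 δ hδ φ hφ) ((hcancel b₂ hb₂ R hR).2.2.2 δ hδ φ hφ)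
    · exact norm_integral_mul_comp_mul_le α hC' (abs_nonneg _) hR hV0 hVb fun y hy =>
        ((hcancel φ hφ δ hδ).1 (α + 1) y hy).trans (by
          gcongr
          exact le_abs_self _)

open FourierTransform in
/-- The scale-invariant `η`-derivatives of the Fourier integral as an oscillatory integral. -/
lemma pow_mul_iteratedDeriv_integral_eI {f : ℝ → ℂ} (hf : Continuous f)
    (hfs : HasCompactSupport f) (α : ℕ) (η : ℝ) :
    (η : ℂ) ^ α * iteratedDeriv α (fun η' : ℝ => ∫ y : ℝ, eI (-2 * π * y * η') * f y) η =
      ∫ y : ℝ, f y * ((-2 * π * Complex.I * (η * y : ℝ)) ^ α *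
        Complex.exp (-2 * π * Complex.I * (η * y : ℝ))) := by
  have hexp (y w : ℝ) (z : ℂ) : Real.fourierChar (-(y * w)) • z = eI (-2 * π * y * w) * z := by
    rw [Circle.smul_def, Real.fourierChar_apply, eI, smul_eq_mul]
    congr 2
    push_cast
    ring
  have hF : (fun η' : ℝ => ∫ y : ℝ, eI (-2 * π * y * η') * f y) = 𝓕 f := by
    funext w
    rw [Real.fourier_real_eq]
    simp_rw [hexp]
  rw [hF, Real.iteratedDeriv_fourier (N := ⊤) (fun n _ => Continuous.integrable_of_hasCompactSupport
    (by fun_prop) hfs.smul_left) le_top, Real.fourier_real_eq, ← integral_const_mul]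
  simp_rw [hexp]
  refine integral_congr_ae (Eventually.of_forall fun y => ?_)
  have : eI (-2 * π * y * η) = Complex.exp (-2 * π * Complex.I * (η * y : ℝ)) := by
    rw [eI]
    congr 1
    push_cast
    ring
  simp only [this, smul_eq_mul, Complex.ofReal_mul, mul_pow]
  ring

/-- For `M` satisfying the flag-`F₁` seminorm bounds and
`M_η(x) = ∫ e^{-2πiyη} M(x,y) dy`, the family `{η^α ∂_η^α M_η}_{η ≠ 0}` is, for each `α`,
a uniformly bounded family of CZ kernels on `ℝ`, with constants depending only on `α`, `β`
and the flag constants. -/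
theorem eta_derivatives_uniform_CZ_family (Cab : ℕ → ℕ → ℝ) (C1 : ℕ → ℝ) (C2 : ℝ) :
    ∃ (D : ℕ → ℕ → ℝ) (E : ℕ → ℝ), ∀ M : ℝ → ℝ → ℂ, FlagF1FunBounds Cab C1 C2 M →
      ∀ (α : ℕ) (η : ℝ), η ≠ 0 →
        (∀ (β : ℕ) (x : ℝ), x ≠ 0 →
          ‖iteratedDeriv β
              (fun x' : ℝ => (η : ℂ) ^ α *
                iteratedDeriv α (fun η' : ℝ => ∫ y : ℝ, eI (-2 * π * y * η') * M x' y) η) x‖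
            ≤ D α β * |x| ^ (-1 - (β : ℝ))) ∧
        (∀ δ : ℝ, 0 < δ → ∀ φ : ℝ → ℝ, IsNormalizedBump φ →
          ‖∫ x : ℝ, ((η : ℂ) ^ α *
              iteratedDeriv α (fun η' : ℝ => ∫ y : ℝ, eI (-2 * π * y * η') * M x y) η) *
              (φ (δ * x) : ℂ)‖ ≤ E α) := by
  have hc : (-2 * π * Complex.I : ℂ) ≠ 0 := by simp [Real.pi_ne_zero]
  have hre : (-2 * π * Complex.I : ℂ).re = 0 := by simp
  choose D₁ E₁ h₁ using FlagF1FunBounds.exists_oscillatory_bounds Cab C1 C2 hc hre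
  choose D₂ E₂ h₂ using FlagF1FunBounds.exists_oscillatory_bounds Cab C1 C2
    (neg_ne_zero.mpr hc) (by rw [Complex.neg_re, hre, neg_zero])
  refine ⟨fun α β => max (D₁ α β) (D₂ α β), fun α => max (E₁ α) (E₂ α), fun M hM α η hη => ?_⟩
  have hM' : IsTestFunction₂ M := ⟨hM.1, hM.2.1⟩
  simp_rw [fun x => pow_mul_iteratedDeriv_integral_eI (hM'.contDiff_right x).continuous
    (hM'.hasCompactSupport_right x) α η]
  rcases hη.lt_or_gt with hη | hη
  · obtain ⟨hD, hE⟩ := h₂ α M hM (-η) (neg_pos.mpr hη)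
    have hneg (y : ℝ) : -(-2 * π * Complex.I : ℂ) * (-η * y : ℝ) =
        -2 * π * Complex.I * (η * y : ℝ) := by
      push_cast
      ring
    simp_rw [hneg] at hD hE
    refine ⟨fun β x hx => (hD β x hx).trans ?_, fun δ hδ φ hφ => (hE δ hδ φ hφ).trans ?_⟩
    · gcongr
      exact le_max_right _ _
    · exact le_max_right _ _
  · obtain ⟨hD, hE⟩ := h₁ α M hM η hη
    refine ⟨fun β x hx => (hD β x hx).trans ?_, fun δ hδ φ hφ => (hE δ hδ φ hφ).trans ?_⟩
    · gcongr
      exact le_max_left _ _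
    · exact le_max_left _ _
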